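/- arXiv:2204.00066 — 2 statements merged into one kernel-verified Lean document; each statement's English description precedes it below -/
import Mathlib

section
/- Let λ be a partition of n with removable cells (i₁,i'₁),…,(i_s,i'_s), and let e(μ) denote the multiplicity of 1 as a root of the polynomial P_μ. Then for each j: if i'_j = 1 (equivalently, λ_N = 1 and j = s) then e(λ↓_j) = e(λ), and otherwise e(λ↓_j) = e(λ) − 1. -/
open Polynomial

/-- `f` represents the partition `λ₁ ≥ λ₂ ≥ … ≥ λ_N > 0` of `n`:
`f i = λᵢ` for `1 ≤ i ≤ N` and `f i = 0` for `i > N`. -/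
def IsPartitionFun (f : ℕ → ℕ) (n N : ℕ) : Prop :=
  (∀ i j, i ≤ j → f j ≤ f i) ∧ (∀ i, 1 ≤ i → (0 < f i ↔ i ≤ N)) ∧
    ∑ i ∈ Finset.Icc 1 N, f i = n

/-- `A` is strictly upper triangular: `A i j = 0` whenever `j ≤ i`. -/
def StrictUpper {m : ℕ} {F : Type*} [Zero F] (A : Matrix (Fin m) (Fin m) F) : Prop :=
  ∀ i j : Fin m, (j : ℕ) ≤ (i : ℕ) → A i j = 0

/-- `A` has Jordan type `λ`: `rank (A ^ k) = Σᵢ max (λᵢ - k) 0` for every `k ≥ 0`. -/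
def HasJordanType {m : ℕ} {F : Type*} [Field F] (A : Matrix (Fin m) (Fin m) F)
    (f : ℕ → ℕ) (N : ℕ) : Prop :=
  ∀ k : ℕ, (A ^ k).rank = ∑ i ∈ Finset.Icc 1 N, (f i - k)

/-- The number of strictly upper triangular `m × m` matrices over `F` of Jordan type `λ`. -/
noncomputable def jordanCount (m : ℕ) (f : ℕ → ℕ) (N : ℕ)
    (F : Type) [Field F] [Fintype F] : ℕ :=
  Nat.card {A : Matrix (Fin m) (Fin m) F // StrictUpper A ∧ HasJordanType A f N}

/-- `dualPart f N j = λ'_j`, the number of parts of `λ` that are `≥ j`. -/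
def dualPart (f : ℕ → ℕ) (N j : ℕ) : ℕ :=
  ((Finset.Icc 1 N).filter fun i => j ≤ f i).card

/-- `alphaCount f N k = α_k`, the number of parts of `λ` equal to `k`. -/
def alphaCount (f : ℕ → ℕ) (N k : ℕ) : ℕ :=
  ((Finset.Icc 1 N).filter fun i => f i = k).card

/-- The rows containing a removable cell of the Young diagram of `λ`:
rows `1 ≤ i ≤ N` with `i = N` or `λ_{i+1} < λᵢ` (for `i = N` the condition
`f (i+1) < f i` holds automatically since `f (N+1) = 0 < f N`). -/
def removables (f : ℕ → ℕ) (N : ℕ) : Finset ℕ :=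
  (Finset.Icc 1 N).filter fun i => f (i + 1) < f i

section Extension

variable {m : ℕ} {F : Type} [Field F]

/-- The block matrix with rows `(B, v)` and `(0, 0)`. -/
def blockExtend (B : Matrix (Fin m) (Fin m) F) (v : Fin m → F) :
    Matrix (Fin m ⊕ Fin 1) (Fin m ⊕ Fin 1) F :=
  Matrix.fromBlocks B (Matrix.replicateCol (Fin 1) v) 0 0

/-- The matrix `B` extended by the last column `v` and a zero last row. -/
def extendColumn (B : Matrix (Fin m) (Fin m) F) (v : Fin m → F) :
    Matrix (Fin (m + 1)) (Fin (m + 1)) F :=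
  Matrix.reindex finSumFinEquiv finSumFinEquiv (blockExtend B v)

/-- The vectors `v` with `B ^ k v ∈ im B ^ (k + 1)`, that is, the subspace `im B + ker B ^ k`. -/
def imageAddKer (B : Matrix (Fin m) (Fin m) F) (k : ℕ) : Submodule F (Fin m → F) :=
  (LinearMap.range (B ^ (k + 1)).mulVecLin).comap (B ^ k).mulVecLin

/-- `c - 1` is the least `k` with `v ∈ im B + ker B ^ k`. Extending `B` by `v` then adds a cell in
column `c` to the Jordan type. -/
def IsAddedColumn (B : Matrix (Fin m) (Fin m) F) (v : Fin m → F) (c : ℕ) : Prop :=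
  1 ≤ c ∧ ∀ k, v ∈ imageAddKer B k ↔ c ≤ k + 1

lemma imageAddKer_mono (B : Matrix (Fin m) (Fin m) F) : Monotone (imageAddKer B) := by
  refine monotone_nat_of_le_succ fun k v hv => ?_
  obtain ⟨w, hw⟩ := hv
  refine ⟨w, ?_⟩
  simp only [Matrix.mulVecLin_apply] at hw ⊢
  rw [pow_succ' B (k + 1), ← Matrix.mulVec_mulVec, hw, Matrix.mulVec_mulVec, ← pow_succ']

lemma finrank_imageAddKer (B : Matrix (Fin m) (Fin m) F) (k : ℕ) :
    Module.finrank F (imageAddKer B k) + (B ^ k).rank = m + (B ^ (k + 1)).rank := by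
  set f := (B ^ k).mulVecLin with hf
  set S := LinearMap.range (B ^ (k + 1)).mulVecLin with hS
  have hle : S ≤ LinearMap.range f := by
    rw [hS, pow_succ, Matrix.mulVecLin_mul]
    exact LinearMap.range_comp_le_range _ _
  have h1 := LinearMap.finrank_range_add_finrank_ker (f.domRestrict (S.comap f))
  have h2 := LinearMap.finrank_range_add_finrank_ker f
  have h3 : LinearMap.range (f.domRestrict (S.comap f)) = S := by
    rw [LinearMap.range_domRestrict, Submodule.map_comap_eq, inf_eq_right.2 hle]
  have h4 : Module.finrank F (LinearMap.ker (f.domRestrict (S.comap f))) =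
      Module.finrank F (LinearMap.ker f) := by
    rw [LinearMap.ker_domRestrict]
    refine (Submodule.comapSubtypeEquivOfLe ?_).finrank_eq
    intro x hx
    simp [LinearMap.mem_ker.1 hx]
  rw [h3, h4] at h1
  simp only [Module.finrank_fin_fun] at h2
  change Module.finrank F (S.comap f) + Module.finrank F (LinearMap.range f) =
    m + Module.finrank F S
  omega

lemma blockExtend_pow_succ (B : Matrix (Fin m) (Fin m) F) (v : Fin m → F) (k : ℕ) :
    blockExtend B v ^ (k + 1) = blockExtend (B ^ (k + 1)) ((B ^ k).mulVec v) := by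
  induction k with
  | zero => simp
  | succ k ih =>
    rw [pow_succ', ih, blockExtend, blockExtend, Matrix.fromBlocks_multiply, ← pow_succ',
      ← Matrix.replicateCol_mulVec,
      Matrix.mulVec_mulVec, ← pow_succ']
    simp [blockExtend]

lemma rank_blockExtend (C : Matrix (Fin m) (Fin m) F) (w : Fin m → F) :
    (blockExtend C w).rank =
      Module.finrank F ↥(LinearMap.range C.mulVecLin ⊔ Submodule.span F {w}) := by
  let e : (Fin m → F) →ₗ[F] (Fin m ⊕ Fin 1 → F) :=
    { toFun := fun x => Sum.elim x 0
      map_add' := fun x y => by ext (i | i) <;> simp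
      map_smul' := fun a x => by ext (i | i) <;> simp }
  have he : Function.Injective e := fun x y h => by
    ext i
    exact congrFun h (Sum.inl i)
  have hrange : LinearMap.range (blockExtend C w).mulVecLin =
      (LinearMap.range C.mulVecLin ⊔ Submodule.span F {w}).map e := by
    ext y
    simp only [LinearMap.mem_range, Submodule.mem_map, Submodule.mem_sup,
      Submodule.mem_span_singleton, Matrix.mulVecLin_apply]
    have hmul (x : Fin m → F) (t : F) :
        (blockExtend C w).mulVec (Sum.elim x fun _ => t) = e (C.mulVec x + t • w) := by
      rw [blockExtend, Matrix.fromBlocks_mulVec]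
      ext (i | i)
      · simp [e, Matrix.mulVec, dotProduct, mul_comm]
      · simp [e]
    constructor
    · rintro ⟨x, rfl⟩
      refine ⟨_, ⟨_, ⟨x ∘ Sum.inl, rfl⟩, _, ⟨x (Sum.inr 0), rfl⟩, rfl⟩, ?_⟩
      rw [← hmul]
      congr 1
      ext (i | i)
      · rfl
      · rw [Subsingleton.elim i 0]
        rfl
    · rintro ⟨_, ⟨_, ⟨x, rfl⟩, _, ⟨t, rfl⟩, rfl⟩, rfl⟩
      exact ⟨_, hmul x t⟩
  rw [Matrix.rank, hrange]
  exact (Submodule.equivMapOfInjective e he _).finrank_eq.symm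

lemma rank_extendColumn_pow (B : Matrix (Fin m) (Fin m) F) (v : Fin m → F) (k : ℕ) :
    (extendColumn B v ^ k).rank =
      (blockExtend B v ^ k).rank := by
  have : extendColumn B v ^ k = Matrix.reindex finSumFinEquiv finSumFinEquiv
      (blockExtend B v ^ k) := by
    exact (map_pow (Matrix.reindexAlgEquiv F F finSumFinEquiv) _ k).symm
  rw [this, Matrix.rank_reindex]

lemma rank_extendColumn_pow_zero (B : Matrix (Fin m) (Fin m) F) (v : Fin m → F) :
    (extendColumn B v ^ 0).rank = (B ^ 0).rank + 1 := by
  simp [Matrix.rank_one]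

lemma rank_extendColumn_pow_succ_of_mem {B : Matrix (Fin m) (Fin m) F} {v : Fin m → F} {k : ℕ}
    (h : v ∈ imageAddKer B k) :
    (extendColumn B v ^ (k + 1)).rank = (B ^ (k + 1)).rank := by
  rw [rank_extendColumn_pow, blockExtend_pow_succ, rank_blockExtend, sup_eq_left.2]
  · rfl
  · rw [Submodule.span_singleton_le_iff_mem]
    exact h

lemma rank_extendColumn_pow_succ_of_notMem {B : Matrix (Fin m) (Fin m) F} {v : Fin m → F} {k : ℕ}
    (h : v ∉ imageAddKer B k) :
    (extendColumn B v ^ (k + 1)).rank = (B ^ (k + 1)).rank + 1 := by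
  rw [rank_extendColumn_pow, blockExtend_pow_succ, rank_blockExtend,
    Submodule.finrank_sup_span_singleton]
  · rfl
  · exact h

lemma IsAddedColumn.rank_extendColumn_pow {B : Matrix (Fin m) (Fin m) F} {v : Fin m → F} {c : ℕ}
    (h : IsAddedColumn B v c) (k : ℕ) :
    (extendColumn B v ^ k).rank = (B ^ k).rank + if k < c then 1 else 0 := by
  obtain ⟨h1, h2⟩ := h
  cases k with
  | zero => rw [rank_extendColumn_pow_zero, if_pos (by omega)]
  | succ k =>
    by_cases hk : v ∈ imageAddKer B k
    · rw [rank_extendColumn_pow_succ_of_mem hk, if_neg, add_zero]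
      have := (h2 k).1 hk
      omega
    · rw [rank_extendColumn_pow_succ_of_notMem hk, if_pos]
      have := mt (h2 k).2 hk
      omega

lemma IsAddedColumn.unique {B : Matrix (Fin m) (Fin m) F} {v : Fin m → F} {c d : ℕ}
    (hc : IsAddedColumn B v c) (hd : IsAddedColumn B v d) : c = d := by
  have h1 := (hc.2 (c - 1)).2 (by omega)
  have h2 := (hd.2 (d - 1)).2 (by omega)
  rw [hd.2] at h1
  rw [hc.2] at h2
  have := hc.1
  have := hd.1
  omega

lemma exists_isAddedColumn {B : Matrix (Fin m) (Fin m) F} {v : Fin m → F} {k : ℕ}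
    (h : (extendColumn B v ^ (k + 1)).rank = 0) : ∃ c, IsAddedColumn B v c := by
  classical
  have hex : ∃ k, v ∈ imageAddKer B k := by
    refine ⟨k, ?_⟩
    by_contra hv
    rw [rank_extendColumn_pow_succ_of_notMem hv] at h
    omega
  refine ⟨Nat.find hex + 1, by omega, fun j => ⟨fun hj => ?_, fun hj => ?_⟩⟩
  · exact Nat.succ_le_succ (Nat.find_min' hex hj)
  · exact imageAddKer_mono B (by omega) (Nat.find_spec hex)

lemma natCard_imageAddKer [Fintype F] (B : Matrix (Fin m) (Fin m) F) (k : ℕ) :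
    Nat.card (imageAddKer B k) = Fintype.card F ^ Module.finrank F (imageAddKer B k) := by
  rw [Module.natCard_eq_pow_finrank (K := F), Nat.card_eq_fintype_card]

lemma natCard_isAddedColumn_one [Fintype F] (B : Matrix (Fin m) (Fin m) F) :
    Nat.card {v // IsAddedColumn B v 1} =
      Fintype.card F ^ Module.finrank F (imageAddKer B 0) := by
  rw [← natCard_imageAddKer]
  refine Nat.card_congr (Equiv.subtypeEquivRight fun v => ?_)
  refine ⟨fun h => (h.2 0).2 (by omega), fun h => ⟨le_rfl, fun k => ?_⟩⟩
  simpa using imageAddKer_mono B (Nat.zero_le k) h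

lemma natCard_isAddedColumn_add_two [Fintype F] (B : Matrix (Fin m) (Fin m) F) (k : ℕ) :
    Nat.card {v // IsAddedColumn B v (k + 2)} +
        Fintype.card F ^ Module.finrank F (imageAddKer B k) =
      Fintype.card F ^ Module.finrank F (imageAddKer B (k + 1)) := by
  rw [← natCard_imageAddKer, ← natCard_imageAddKer]
  have h : {v | IsAddedColumn B v (k + 2)} =
      (imageAddKer B (k + 1) : Set (Fin m → F)) \ imageAddKer B k := by
    ext v
    simp only [Set.mem_ofPred_eq, Set.mem_sdiff, SetLike.mem_coe]
    refine ⟨fun h => ⟨(h.2 _).2 le_rfl, fun hk => ?_⟩, fun h => ⟨by omega, fun j => ?_⟩⟩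
    · have := (h.2 _).1 hk
      omega
    · refine ⟨fun hj => ?_, fun hj => imageAddKer_mono B (by omega) h.1⟩
      by_contra hlt
      exact h.2 (imageAddKer_mono B (by omega) hj)
  change Set.ncard {v | IsAddedColumn B v (k + 2)} +
    Set.ncard (imageAddKer B k : Set (Fin m → F)) =
      Set.ncard (imageAddKer B (k + 1) : Set (Fin m → F))
  rw [h]
  exact Set.ncard_sdiff_add_ncard_of_subset (imageAddKer_mono B k.le_succ) (Set.toFinite _)

@[simp]
lemma extendColumn_castSucc_castSucc (B : Matrix (Fin m) (Fin m) F) (v : Fin m → F)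
    (i j : Fin m) : extendColumn B v i.castSucc j.castSucc = B i j := by
  simp [extendColumn, blockExtend, Fin.castSucc]

@[simp]
lemma extendColumn_castSucc_last (B : Matrix (Fin m) (Fin m) F) (v : Fin m → F) (i : Fin m) :
    extendColumn B v i.castSucc (Fin.last m) = v i := by
  simp [extendColumn, blockExtend, Fin.castSucc]

@[simp]
lemma extendColumn_last (B : Matrix (Fin m) (Fin m) F) (v : Fin m → F) (j : Fin (m + 1)) :
    extendColumn B v (Fin.last m) j = 0 := by
  induction j using Fin.lastCases <;> simp [extendColumn, blockExtend, Fin.castSucc]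

lemma strictUpper_extendColumn {B : Matrix (Fin m) (Fin m) F} {v : Fin m → F} :
    StrictUpper (extendColumn B v) ↔ StrictUpper B := by
  refine ⟨fun h i j hij => by simpa using h i.castSucc j.castSucc hij, fun h i j hij => ?_⟩
  induction i using Fin.lastCases with
  | last => simp
  | cast i =>
    induction j using Fin.lastCases with
    | last => simp at hij; omega
    | cast j => simpa using h i j hij

/-- Every strictly upper triangular matrix arises from a unique smaller one and a unique column. -/
lemma natCard_strictUpper_succ (p : Matrix (Fin (m + 1)) (Fin (m + 1)) F → Prop) :
    Nat.card {A // StrictUpper A ∧ p A} =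
      Nat.card {x : Matrix (Fin m) (Fin m) F × (Fin m → F) //
        StrictUpper x.1 ∧ p (extendColumn x.1 x.2)} := by
  symm
  refine Nat.card_eq_of_bijective (fun x => ⟨extendColumn x.1.1 x.1.2,
    strictUpper_extendColumn.2 x.2.1, x.2.2⟩) ⟨?_, ?_⟩
  · rintro ⟨⟨B, v⟩, _⟩ ⟨⟨C, w⟩, _⟩ h
    replace h : extendColumn B v = extendColumn C w := congrArg Subtype.val h
    ext i j
    · simpa using congrFun₂ h i.castSucc j.castSucc
    · simpa using congrFun₂ h i.castSucc (Fin.last m)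
  · rintro ⟨A, hA, hp⟩
    obtain ⟨B, v, rfl⟩ : ∃ B v, A = extendColumn B v := by
      refine ⟨Matrix.of fun i j => A i.castSucc j.castSucc, fun i => A i.castSucc (Fin.last m), ?_⟩
      ext i j
      induction i using Fin.lastCases with
      | last => simpa using hA _ _ (Fin.le_last j)
      | cast i => induction j using Fin.lastCases <;> simp
    exact ⟨⟨(B, v), strictUpper_extendColumn.1 hA, hp⟩, rfl⟩

end Extension

section Partition

/-- The number of cells of the diagram of `λ` outside the first `k` columns. -/
def cellsBeyond (f : ℕ → ℕ) (N k : ℕ) : ℕ := ∑ i ∈ Finset.Icc 1 N, (f i - k)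

/-- The partition `λ` with the last cell of row `i` removed. -/
def removeCell (f : ℕ → ℕ) (i : ℕ) : ℕ → ℕ := Function.update f i (f i - 1)

/-- The number of parts of `removeCell f i`. -/
def partsAfterRemoval (f : ℕ → ℕ) (N i : ℕ) : ℕ := if f i = 1 then N - 1 else N

variable {f : ℕ → ℕ} {n N : ℕ}

lemma cellsBeyond_convex (f : ℕ → ℕ) (N k : ℕ) :
    2 * cellsBeyond f N (k + 1) ≤ cellsBeyond f N k + cellsBeyond f N (k + 2) := by
  simp only [cellsBeyond, Finset.mul_sum, ← Finset.sum_add_distrib]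
  exact Finset.sum_le_sum fun i _ => by omega

lemma exists_eq_of_cellsBeyond_lt {k : ℕ}
    (h : 2 * cellsBeyond f N (k + 1) < cellsBeyond f N k + cellsBeyond f N (k + 2)) :
    ∃ i ∈ Finset.Icc 1 N, f i = k + 1 := by
  by_contra! hne
  refine h.not_ge ?_
  simp only [cellsBeyond, Finset.mul_sum, ← Finset.sum_add_distrib]
  exact Finset.sum_le_sum fun i hi => by have := hne i hi; omega

lemma IsPartitionFun.cellsBeyond_zero (hf : IsPartitionFun f n N) : cellsBeyond f N 0 = n := by
  simpa [cellsBeyond] using hf.2.2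

lemma IsPartitionFun.cellsBeyond_self (hf : IsPartitionFun f n N) : cellsBeyond f N n = 0 := by
  refine Finset.sum_eq_zero fun i hi => ?_
  have := Finset.single_le_sum (fun j _ => Nat.zero_le (f j)) hi
  rw [hf.2.2] at this
  omega

lemma IsPartitionFun.pos_of_mem (hf : IsPartitionFun f n N) {i : ℕ} (hi : i ∈ Finset.Icc 1 N) :
    0 < f i := by
  rw [Finset.mem_Icc] at hi
  exact (hf.2.1 i hi.1).2 hi.2

lemma IsPartitionFun.parts_le (hf : IsPartitionFun f n N) : N ≤ n := by
  rw [← hf.2.2]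
  simpa using Finset.card_nsmul_le_sum _ f 1 fun i hi => hf.pos_of_mem hi

lemma IsPartitionFun.parts_pos (hf : IsPartitionFun f (n + 1) N) : 0 < N := by
  by_contra h
  have := hf.2.2
  simp [show N = 0 by omega] at this

lemma IsPartitionFun.parts_mem_removables (hf : IsPartitionFun f n N) (hN : 0 < N) :
    N ∈ removables f N := by
  simp only [removables, Finset.mem_filter, Finset.mem_Icc]
  have h1 := (hf.2.1 N hN).2 le_rfl
  have h2 := mt (hf.2.1 (N + 1) (by omega)).1 (by omega)
  omega

lemma mem_removables {i : ℕ} : i ∈ removables f N ↔ (1 ≤ i ∧ i ≤ N) ∧ f (i + 1) < f i := by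
  simp [removables]

lemma IsPartitionFun.eq_parts (hf : IsPartitionFun f n N) {i : ℕ} (hi : i ∈ removables f N)
    (h1 : f i = 1) : i = N := by
  obtain ⟨⟨hi1, hiN⟩, hlt⟩ := mem_removables.1 hi
  have := mt (hf.2.1 (i + 1) (by omega)).2
  omega

lemma IsPartitionFun.eq_of_removables (hf : IsPartitionFun f n N) {i j : ℕ}
    (hi : i ∈ removables f N) (hj : j ∈ removables f N) (h : f i = f j) : i = j := by
  have hi2 := (mem_removables.1 hi).2
  have hj2 := (mem_removables.1 hj).2
  rcases lt_trichotomy i j with hij | hij | hij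
  · have := hf.1 (i + 1) j hij
    omega
  · exact hij
  · have := hf.1 (j + 1) i hij
    omega

lemma IsPartitionFun.exists_removable (hf : IsPartitionFun f n N) {c : ℕ}
    (h : ∃ i ∈ Finset.Icc 1 N, f i = c) : ∃ i ∈ removables f N, f i = c := by
  have hne : ((Finset.Icc 1 N).filter (f · = c)).Nonempty := by
    obtain ⟨i, hi, hc⟩ := h
    exact ⟨i, Finset.mem_filter.2 ⟨hi, hc⟩⟩
  obtain ⟨i, hi, hmax⟩ := Finset.exists_max_image _ id hne
  obtain ⟨hiN, hc⟩ := Finset.mem_filter.1 hi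
  have hpos := hf.pos_of_mem hiN
  refine ⟨i, Finset.mem_filter.2 ⟨hiN, lt_of_le_of_ne (hf.1 _ _ i.le_succ) fun heq => ?_⟩, hc⟩
  have hsucc : i + 1 ∈ Finset.Icc 1 N :=
    Finset.mem_Icc.2 ⟨by omega, (hf.2.1 (i + 1) (by omega)).1 (by omega)⟩
  have := hmax (i + 1) (Finset.mem_filter.2 ⟨hsucc, heq.trans hc⟩)
  simp at this

lemma IsPartitionFun.cellsBeyond_removeCell (hf : IsPartitionFun f n N) {i : ℕ}
    (hi : i ∈ removables f N) (k : ℕ) :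
    cellsBeyond (removeCell f i) (partsAfterRemoval f N i) k + (if k < f i then 1 else 0) =
      cellsBeyond f N k := by
  have hiN : i ∈ Finset.Icc 1 N := Finset.filter_subset _ _ hi
  have h1 : cellsBeyond (removeCell f i) (partsAfterRemoval f N i) k =
      cellsBeyond (removeCell f i) N k := by
    unfold partsAfterRemoval
    split_ifs with h
    · obtain rfl := hf.eq_parts hi h
      obtain ⟨j, rfl⟩ : ∃ j, i = j + 1 := ⟨i - 1, by have := Finset.mem_Icc.1 hiN; omega⟩
      simp [cellsBeyond, Finset.sum_Icc_succ_top, removeCell, h]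
    · rfl
  rw [h1, cellsBeyond, cellsBeyond, ← Finset.add_sum_erase _ _ hiN, ← Finset.add_sum_erase _ _ hiN]
  have h2 : ∑ j ∈ (Finset.Icc 1 N).erase i, (removeCell f i j - k) =
      ∑ j ∈ (Finset.Icc 1 N).erase i, (f j - k) :=
    Finset.sum_congr rfl fun j hj => by
      rw [removeCell, Function.update_of_ne (Finset.ne_of_mem_erase hj)]
  rw [h2, removeCell, Function.update_self]
  split_ifs <;> omega

lemma IsPartitionFun.removeCell (hf : IsPartitionFun f n N) {i : ℕ} (hi : i ∈ removables f N) :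
    IsPartitionFun (removeCell f i) (n - 1) (partsAfterRemoval f N i) := by
  obtain ⟨⟨hi1, hiN⟩, hlt⟩ := mem_removables.1 hi
  refine ⟨fun a b hab => ?_, fun j hj => ?_, ?_⟩
  · have hmono := hf.1 a b hab
    by_cases ha : a = i <;> by_cases hb : b = i
    · rw [ha, hb]
    · subst ha
      have := hf.1 (a + 1) b (by omega)
      simp only [_root_.removeCell, Function.update_self, Function.update_of_ne hb]
      omega
    · subst hb
      simp only [_root_.removeCell, Function.update_self, Function.update_of_ne ha]
      omega
    · simpa only [_root_.removeCell, Function.update_of_ne ha, Function.update_of_ne hb]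
  · have hfj := hf.2.1 j hj
    have hpart := hf.eq_parts hi
    unfold partsAfterRemoval
    by_cases hji : j = i
    · subst hji
      simp only [_root_.removeCell, Function.update_self]
      split_ifs with h
      · omega
      · have := hfj.2 hiN
        omega
    · simp only [_root_.removeCell, Function.update_of_ne hji]
      split_ifs with h
      · have := hpart h
        omega
      · exact hfj
  · have h := hf.cellsBeyond_removeCell hi 0
    rw [hf.cellsBeyond_zero, if_pos (by omega)] at h
    simp only [cellsBeyond, Nat.sub_zero] at h
    omega

end Partition

section Recursion

variable {f : ℕ → ℕ} {m N : ℕ} {F : Type} [Field F]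

lemma hasJordanType_iff {A : Matrix (Fin m) (Fin m) F} :
    HasJordanType A f N ↔ ∀ k, (A ^ k).rank = cellsBeyond f N k := Iff.rfl

lemma hasJordanType_extendColumn_iff (hf : IsPartitionFun f (m + 1) N)
    (B : Matrix (Fin m) (Fin m) F) (v : Fin m → F) :
    HasJordanType (extendColumn B v) f N ↔ ∃ i ∈ removables f N,
      HasJordanType B (removeCell f i) (partsAfterRemoval f N i) ∧ IsAddedColumn B v (f i) := by
  simp only [hasJordanType_iff]
  constructor
  · intro h
    obtain ⟨c, hc⟩ := exists_isAddedColumn (k := m) ((h (m + 1)).trans hf.cellsBeyond_self)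
    have hrank (k : ℕ) : (B ^ k).rank + (if k < c then 1 else 0) = cellsBeyond f N k := by
      rw [← hc.rank_extendColumn_pow, h]
    obtain ⟨d, rfl⟩ : ∃ d, c = d + 1 := ⟨c - 1, by have := hc.1; omega⟩
    have hconv : 2 * cellsBeyond f N (d + 1) < cellsBeyond f N d + cellsBeyond f N (d + 2) := by
      have h0 := hrank d
      have h1 := hrank (d + 1)
      have h2 := hrank (d + 2)
      rw [if_pos (by omega)] at h0
      rw [if_neg (by omega)] at h1 h2
      have e0 := finrank_imageAddKer B d
      have e1 := finrank_imageAddKer B (d + 1)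
      have hle := Submodule.finrank_mono (imageAddKer_mono B d.le_succ)
      simp only [Nat.succ_eq_add_one, add_assoc, Nat.reduceAdd] at *
      omega
    obtain ⟨i, hi, hfi⟩ := hf.exists_removable (exists_eq_of_cellsBeyond_lt hconv)
    refine ⟨i, hi, fun k => ?_, hfi ▸ hc⟩
    have h1 := hf.cellsBeyond_removeCell hi k
    rw [← hrank k, hfi] at h1
    omega
  · rintro ⟨i, hi, hB, hv⟩ k
    rw [hv.rank_extendColumn_pow, hB, hf.cellsBeyond_removeCell hi]

/-- The dimension of `im B + ker B ^ (c - 1)` when removing a cell in column `c` from `λ` gives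
the Jordan type of `B`. -/
def addedDim (f : ℕ → ℕ) (m N c : ℕ) : ℕ := m + 1 + cellsBeyond f N c - cellsBeyond f N (c - 1)

/-- The number of columns that add a cell in column `c`, as a polynomial in the field size, without
its factor `X - 1` when `2 ≤ c`. -/
noncomputable def columnWeight (f : ℕ → ℕ) (m N c : ℕ) : ℤ[X] :=
  if c = 1 then X ^ addedDim f m N 1
  else X ^ (addedDim f m N (c - 1) - 1) *
    ∑ t ∈ Finset.range (addedDim f m N c + 1 - addedDim f m N (c - 1)), X ^ t

lemma natCard_isAddedColumn [Fintype F] (hf : IsPartitionFun f (m + 1) N) {i : ℕ}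
    (hi : i ∈ removables f N) {B : Matrix (Fin m) (Fin m) F}
    (hB : HasJordanType B (removeCell f i) (partsAfterRemoval f N i)) :
    (Nat.card {v // IsAddedColumn B v (f i)} : ℤ) =
      ((if f i = 1 then 1 else X - 1) * columnWeight f m N (f i)).eval (Fintype.card F : ℤ) := by
  have hrank (k : ℕ) : (B ^ k).rank + (if k < f i then 1 else 0) = cellsBeyond f N k := by
    rw [hB, ← hf.cellsBeyond_removeCell hi]
    rfl
  have hpos : 0 < f i := hf.pos_of_mem (Finset.filter_subset _ _ hi)
  have hdim (k : ℕ) (hk : k + 1 = f i) :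
      Module.finrank F (imageAddKer B k) = addedDim f m N (k + 1) := by
    have e := finrank_imageAddKer B k
    have h0 := hrank k
    have h1 := hrank (k + 1)
    rw [if_pos (by omega)] at h0
    rw [if_neg (by omega)] at h1
    simp only [addedDim, Nat.add_sub_cancel]
    omega
  unfold columnWeight
  split_ifs with h1
  · rw [h1, natCard_isAddedColumn_one, hdim 0 h1.symm]
    simp
  · obtain ⟨k, hk⟩ : ∃ k, f i = k + 2 := ⟨f i - 2, by omega⟩
    have hdim' : Module.finrank F (imageAddKer B k) = addedDim f m N (k + 1) - 1 := by
      have e := finrank_imageAddKer B k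
      have h0 := hrank k
      have h1 := hrank (k + 1)
      rw [if_pos (by omega)] at h0 h1
      simp only [addedDim, Nat.add_sub_cancel]
      omega
    have hcard := natCard_isAddedColumn_add_two B k
    have hle := Submodule.finrank_mono (imageAddKer_mono B k.le_succ)
    have hd1 := hdim (k + 1) hk.symm
    have hp : 0 < addedDim f m N (k + 1) := by
      have h0 := hrank k
      have h1 := hrank (k + 1)
      have e := finrank_imageAddKer B k
      rw [if_pos (by omega)] at h0 h1
      simp only [addedDim, Nat.add_sub_cancel]
      omega
    rw [hdim', hd1] at hcard
    rw [hdim', Nat.succ_eq_add_one, hd1] at hle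
    rw [hk]
    generalize Nat.card {v // IsAddedColumn B v (k + 2)} = C at *
    rw [show k + 2 - 1 = k + 1 by omega]
    obtain ⟨a, ha⟩ : ∃ a, addedDim f m N (k + 2) = addedDim f m N (k + 1) - 1 + a :=
      ⟨_, (Nat.add_sub_of_le hle).symm⟩
    have ha' : addedDim f m N (k + 2) + 1 - addedDim f m N (k + 1) = a := by omega
    rw [ha']
    simp only [ha, pow_add] at hcard
    simp only [eval_mul, eval_sub, eval_X, eval_one, eval_pow, eval_finsetSum]
    have hgeom := mul_geom_sum (Fintype.card F : ℤ) a
    zify at hcard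
    linear_combination hcard - (Fintype.card F : ℤ) ^ (addedDim f m N (k + 1) - 1) * hgeom

lemma eval_one_columnWeight_pos (hf : IsPartitionFun f (m + 1) N) {i : ℕ}
    (hi : i ∈ removables f N) : 0 < (columnWeight f m N (f i)).eval 1 := by
  unfold columnWeight
  split_ifs with h1
  · simp
  · have hpos : 0 < f i := hf.pos_of_mem (Finset.filter_subset _ _ hi)
    obtain ⟨k, hk⟩ : ∃ k, f i = k + 2 := ⟨f i - 2, by omega⟩
    have hconv := cellsBeyond_convex f N k
    have hlt : cellsBeyond f N (k + 1) ≤ cellsBeyond f N k :=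
      Finset.sum_le_sum fun i _ => by omega
    have hle : cellsBeyond f N k ≤ m + 1 := by
      rw [← hf.cellsBeyond_zero]
      exact Finset.sum_le_sum fun i _ => by omega
    simp only [hk, eval_mul, eval_pow, eval_X, one_pow, eval_finsetSum, Finset.sum_const,
      Finset.card_range, one_mul, nsmul_eq_mul, mul_one, addedDim]
    simp only [show k + 2 - 1 = k + 1 by omega, Nat.add_sub_cancel]
    norm_cast
    omega

lemma jordanCount_succ [Fintype F] (hf : IsPartitionFun f (m + 1) N) :
    (jordanCount (m + 1) f N F : ℤ) = ∑ i ∈ removables f N,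
      jordanCount m (removeCell f i) (partsAfterRemoval f N i) F *
      ((if f i = 1 then 1 else X - 1) * columnWeight f m N (f i)).eval (Fintype.card F : ℤ) := by
  rw [jordanCount, natCard_strictUpper_succ (HasJordanType · f N)]
  let e : (Σ i : removables f N, Σ B : {B : Matrix (Fin m) (Fin m) F // StrictUpper B ∧
        HasJordanType B (removeCell f i) (partsAfterRemoval f N i)},
        {v // IsAddedColumn B.1 v (f i)}) →
      {x : Matrix (Fin m) (Fin m) F × (Fin m → F) //
        StrictUpper x.1 ∧ HasJordanType (extendColumn x.1 x.2) f N} := fun y =>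
    ⟨(y.2.1.1, y.2.2.1), y.2.1.2.1,
      (hasJordanType_extendColumn_iff hf _ _).2 ⟨y.1, y.1.2, y.2.1.2.2, y.2.2.2⟩⟩
  have he : Function.Bijective e := by
    constructor
    · rintro ⟨i, ⟨B, hB⟩, ⟨v, hv⟩⟩ ⟨j, ⟨C, hC⟩, ⟨w, hw⟩⟩ h
      obtain ⟨rfl, rfl⟩ : B = C ∧ v = w := Prod.mk.inj (congrArg Subtype.val h)
      obtain rfl : i = j := Subtype.ext (hf.eq_of_removables i.2 j.2 (hv.unique hw))
      rfl
    · rintro ⟨⟨B, v⟩, hB, h⟩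
      obtain ⟨i, hi, hBi, hv⟩ := (hasJordanType_extendColumn_iff hf _ _).1 h
      exact ⟨⟨⟨i, hi⟩, ⟨B, hB, hBi⟩, ⟨v, hv⟩⟩, rfl⟩
  rw [← Nat.card_eq_of_bijective e he, Nat.card_sigma, Nat.cast_sum,
    ← Finset.sum_coe_sort (removables f N)]
  refine Finset.sum_congr rfl fun i _ => ?_
  have := Fintype.ofFinite {B : Matrix (Fin m) (Fin m) F // StrictUpper B ∧
        HasJordanType B (removeCell f i) (partsAfterRemoval f N i)}
  rw [Nat.card_sigma, Nat.cast_sum,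
    Finset.sum_congr rfl fun B _ => natCard_isAddedColumn hf i.2 B.2.2, Finset.sum_const,
    Finset.card_univ, nsmul_eq_mul, jordanCount, Nat.card_eq_fintype_card]

lemma jordanCount_zero [Fintype F] (hf : IsPartitionFun f 0 N) : jordanCount 0 f N F = 1 := by
  obtain rfl : N = 0 := Nat.le_zero.1 hf.parts_le
  rw [jordanCount, Nat.card_eq_one_iff_unique]
  refine ⟨inferInstance, ⟨0, fun i => i.elim0, fun k => ?_⟩⟩
  rw [Subsingleton.elim (_ ^ k) 0, Matrix.rank_zero]
  rfl

end Recursion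

lemma exists_jordanCount_eq (n : ℕ) : ∀ {f : ℕ → ℕ} {N : ℕ}, IsPartitionFun f n N →
    ∃ R : ℤ[X], 0 < R.eval 1 ∧ ∀ (F : Type) [Field F] [Fintype F],
      (jordanCount n f N F : ℤ) = ((X - 1) ^ (n - N) * R).eval (Fintype.card F : ℤ) := by
  induction n with
  | zero =>
    intro f N hf
    exact ⟨1, by simp, fun F _ _ => by simp [jordanCount_zero hf]⟩
  | succ n ih =>
    intro f N hf
    have hex : ∀ i : removables f N, ∃ R : ℤ[X], 0 < R.eval 1 ∧
        ∀ (F : Type) [Field F] [Fintype F],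
          (jordanCount n (removeCell f i) (partsAfterRemoval f N i) F : ℤ) =
            ((X - 1) ^ (n - partsAfterRemoval f N i) * R).eval (Fintype.card F : ℤ) :=
      fun i => ih (hf.removeCell i.2)
    choose R hR1 hR using hex
    refine ⟨∑ i : removables f N, R i * columnWeight f n N (f i), ?_, fun F _ _ => ?_⟩
    · rw [eval_finsetSum]
      refine Finset.sum_pos (fun i _ => ?_)
        ⟨⟨N, hf.parts_mem_removables hf.parts_pos⟩, Finset.mem_univ _⟩
      rw [eval_mul]
      exact mul_pos (hR1 i) (eval_one_columnWeight_pos hf i.2)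
    · rw [jordanCount_succ hf, ← Finset.sum_coe_sort, Finset.mul_sum, eval_finsetSum]
      refine Finset.sum_congr rfl fun i _ => ?_
      rw [hR, ← eval_mul]
      congr 1
      have hpos := hf.parts_pos
      have hle := (hf.removeCell i.2).parts_le
      unfold partsAfterRemoval at *
      split_ifs at * with h
      · rw [show n + 1 - N = n - (N - 1) by omega]
        ring
      · rw [show n + 1 - N = n - N + 1 by simp at hle; omega]
        ring

lemma eq_of_eval_card_eq {P Q : ℤ[X]} (h : ∀ (F : Type) [Field F] [Fintype F],
    P.eval (Fintype.card F : ℤ) = Q.eval (Fintype.card F : ℤ)) : P = Q := by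
  refine eq_of_infinite_eval_eq P Q
    ((Nat.infinite_setOfPred_prime.image Nat.cast_injective.injOn).mono ?_)
  rintro _ ⟨p, hp, rfl⟩
  have : Fact p.Prime := ⟨hp⟩
  simpa using h (ZMod p)

/-- The multiplicity of the root `1` is the number of cells outside the first column. -/
lemma rootMultiplicity_one_eq {n N : ℕ} {f : ℕ → ℕ} (hf : IsPartitionFun f n N) {P : ℤ[X]}
    (hP : ∀ (F : Type) [Field F] [Fintype F],
      (jordanCount n f N F : ℤ) = P.eval (Fintype.card F : ℤ)) :
    P.rootMultiplicity 1 = n - N := by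
  obtain ⟨R, hR1, hR⟩ := exists_jordanCount_eq n hf
  obtain rfl : P = (X - 1) ^ (n - N) * R := eq_of_eval_card_eq fun F _ _ => by rw [← hP, hR]
  have hR0 : R ≠ 0 := by
    rintro rfl
    simp at hR1
  rw [mul_comm, ← C_1, rootMultiplicity_mul_X_sub_C_pow hR0, rootMultiplicity_eq_zero hR1.ne',
    zero_add]

theorem e_of_remove (n N : ℕ) (f : ℕ → ℕ) (hf : IsPartitionFun f n N)
    (i : ℕ) (hi : i ∈ removables f N)
    (P : Polynomial ℤ)
    (hP : ∀ (F : Type) [Field F] [Fintype F],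
      (jordanCount n f N F : ℤ) = P.eval (Fintype.card F : ℤ))
    (P' : Polynomial ℤ)
    (hP' : ∀ (F : Type) [Field F] [Fintype F],
      (jordanCount (n - 1) (Function.update f i (f i - 1))
          (if f i = 1 then N - 1 else N) F : ℤ) = P'.eval (Fintype.card F : ℤ)) :
    (f i = 1 → P'.rootMultiplicity 1 = P.rootMultiplicity 1) ∧
      (f i ≠ 1 → P'.rootMultiplicity 1 + 1 = P.rootMultiplicity 1) := by
  have hpos : 0 < f i := hf.pos_of_mem (Finset.filter_subset _ _ hi)
  have hle := hf.parts_le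
  have hN : 1 ≤ N := (mem_removables.1 hi).1.1.trans (mem_removables.1 hi).1.2
  have hf' := hf.removeCell hi
  have hle' := hf'.parts_le
  rw [rootMultiplicity_one_eq hf hP, rootMultiplicity_one_eq hf' hP']
  unfold partsAfterRemoval at *
  split_ifs at * <;> omega
end

section
/- Let λ be a partition of n with N parts, dual partition λ' with N' = λ₁ parts, and let P_λ ∈ ℤ[x] be the polynomial such that P_λ(|F|) equals the number of strictly upper triangular n×n matrices over F of Jordan type λ for every finite field F. Then the multiplicity d(λ) of 0 as a root of P_λ satisfies d(λ) = C(n,2) − C(N,2) − Σ_{i=1}^{N'−1} λ'_i λ'_{i+1}, where C(a,2) = a(a−1)/2. -/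
open Polynomial

/-- `A` has Jordan type with dual partition `s`, indexed from `0`. -/
def HasDualType {m : ℕ} {F : Type*} [Field F] (A : Matrix (Fin m) (Fin m) F)
    (s : ℕ → ℕ) : Prop :=
  ∀ k : ℕ, (A ^ k).rank = (A ^ (k + 1)).rank + s k

/-- The matrix obtained from `A` by appending the column `v` and then a zero row. -/
def border {m : ℕ} {F : Type*} [Zero F] (A : Matrix (Fin m) (Fin m) F) (v : Fin m → F) :
    Matrix (Fin (m + 1)) (Fin (m + 1)) F :=
  Matrix.of (Fin.snoc (fun i => Fin.snoc (A i) (v i)) 0 : Fin (m + 1) → Fin (m + 1) → F)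

/-- The vectors whose image under `A ^ j` lies in the range of `A ^ (j + 1)`. -/
def jumpSpace {m : ℕ} {F : Type*} [Field F] (A : Matrix (Fin m) (Fin m) F) (j : ℕ) :
    Submodule F (Fin m → F) :=
  (LinearMap.range (A ^ (j + 1)).mulVecLin).comap (A ^ j).mulVecLin

theorem StrictUpper.pow_apply_eq_zero {m : ℕ} {F : Type*} [Field F]
    {A : Matrix (Fin m) (Fin m) F} (hA : StrictUpper A) (k : ℕ) (i j : Fin m)
    (hij : (j : ℕ) < i + k) : (A ^ k) i j = 0 := by
  induction k generalizing i with
  | zero => exact Matrix.one_apply_ne (by rintro rfl; omega)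
  | succ k ih =>
    rw [pow_succ', Matrix.mul_apply]
    refine Finset.sum_eq_zero fun l _ => ?_
    by_cases hl : (l : ℕ) ≤ i
    · rw [hA i l hl, zero_mul]
    · rw [ih l (by omega), mul_zero]

theorem StrictUpper.pow_eq_zero {m : ℕ} {F : Type*} [Field F]
    {A : Matrix (Fin m) (Fin m) F} (hA : StrictUpper A) {k : ℕ} (hk : m ≤ k) : A ^ k = 0 := by
  ext i j
  exact hA.pow_apply_eq_zero k i j (by omega)

section Border

variable {m : ℕ} {F : Type*} [Field F] (A : Matrix (Fin m) (Fin m) F) (v : Fin m → F)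

theorem border_mulVec_snoc (x : Fin m → F) (t : F) :
    (border A v).mulVec (Fin.snoc x t : Fin (m + 1) → F) =
      (Fin.snoc (A.mulVec x + t • v) 0 : Fin (m + 1) → F) := by
  ext i
  refine Fin.lastCases ?_ (fun i => ?_) i <;>
    simp [border, Matrix.mulVec, dotProduct, Fin.sum_univ_castSucc, mul_comm]

theorem border_pow_mulVec_snoc (k : ℕ) (x : Fin m → F) (t : F) :
    (border A v ^ (k + 1)).mulVec (Fin.snoc x t : Fin (m + 1) → F) =
      (Fin.snoc ((A ^ (k + 1)).mulVec x + t • (A ^ k).mulVec v) 0 : Fin (m + 1) → F) := by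
  induction k with
  | zero => simp [border_mulVec_snoc]
  | succ k ih =>
    rw [pow_succ', ← Matrix.mulVec_mulVec, ih, border_mulVec_snoc, zero_smul, add_zero,
      Matrix.mulVec_add, Matrix.mulVec_smul, Matrix.mulVec_mulVec, Matrix.mulVec_mulVec,
      ← pow_succ', ← pow_succ']

/-- Appending a zero coordinate, as a linear map. -/
def snocZero (m : ℕ) (F : Type*) [Field F] : (Fin m → F) →ₗ[F] (Fin (m + 1) → F) where
  toFun x := Fin.snoc x 0
  map_add' x y := by
    ext i; refine Fin.lastCases ?_ (fun i => ?_) i <;> simp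
  map_smul' c x := by
    ext i; refine Fin.lastCases ?_ (fun i => ?_) i <;> simp

theorem snocZero_injective : Function.Injective (snocZero m F) :=
  by
  intro x y h
  ext i
  simpa [snocZero] using congrFun h i.castSucc

theorem range_border_pow (k : ℕ) :
    LinearMap.range (border A v ^ (k + 1)).mulVecLin =
      (LinearMap.range (A ^ (k + 1)).mulVecLin ⊔
        Submodule.span F {(A ^ k).mulVec v}).map (snocZero m F) := by
  ext y
  simp only [LinearMap.mem_range, Submodule.mem_map, Submodule.mem_sup,
    Submodule.mem_span_singleton, Matrix.mulVecLin_apply]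
  constructor
  · rintro ⟨x, rfl⟩
    refine ⟨_, ⟨_, ⟨Fin.init x, rfl⟩, _, ⟨x (Fin.last m), rfl⟩, rfl⟩, ?_⟩
    conv_rhs => rw [← Fin.snoc_init_self x]
    exact (border_pow_mulVec_snoc A v k _ _).symm
  · rintro ⟨_, ⟨_, ⟨x, rfl⟩, _, ⟨t, rfl⟩, rfl⟩, rfl⟩
    exact ⟨Fin.snoc x t, border_pow_mulVec_snoc A v k x t⟩

open Classical in
theorem rank_border_pow (k : ℕ) :
    (border A v ^ (k + 1)).rank =
      (A ^ (k + 1)).rank + if v ∈ jumpSpace A k then 0 else 1 := by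
  rw [Matrix.rank, range_border_pow,
    ← (Submodule.equivMapOfInjective _ snocZero_injective _).finrank_eq]
  split_ifs with h
  · have h' : Submodule.span F {(A ^ k).mulVec v} ≤ LinearMap.range (A ^ (k + 1)).mulVecLin := by
      rw [Submodule.span_singleton_le_iff_mem]
      exact h
    rw [sup_eq_left.2 h', Matrix.rank, add_zero]
  · exact Submodule.finrank_sup_span_singleton h

theorem jumpSpace_mono : Monotone (jumpSpace A) := by
  refine monotone_nat_of_le_succ fun j v hv => ?_
  obtain ⟨u, hu⟩ := hv
  refine ⟨u, ?_⟩
  simp only [Matrix.mulVecLin_apply] at hu ⊢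
  rw [pow_succ', ← Matrix.mulVec_mulVec, hu, Matrix.mulVec_mulVec, ← pow_succ']

theorem mem_jumpSpace (hA : StrictUpper A) {k : ℕ} (hk : m ≤ k) : v ∈ jumpSpace A k :=
  ⟨0, by simp [hA.pow_eq_zero hk]⟩

theorem finrank_jumpSpace (j : ℕ) :
    Module.finrank F (jumpSpace A j) + (A ^ j).rank = m + (A ^ (j + 1)).rank := by
  have h1 := ((A ^ j).mulVecLin.domRestrict (jumpSpace A j)).finrank_range_add_finrank_ker
  have h2 := (A ^ j).mulVecLin.finrank_range_add_finrank_ker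
  have hle : LinearMap.range (A ^ (j + 1)).mulVecLin ≤ LinearMap.range (A ^ j).mulVecLin := by
    rw [pow_succ, Matrix.mulVecLin_mul]
    exact LinearMap.range_comp_le_range _ _
  have hker : LinearMap.ker (A ^ j).mulVecLin ≤ jumpSpace A j := fun x hx => by
    rw [jumpSpace, Submodule.mem_comap, LinearMap.mem_ker.1 hx]
    exact zero_mem _
  rw [LinearMap.range_domRestrict, LinearMap.ker_domRestrict,
    (Submodule.comapSubtypeEquivOfLe hker).finrank_eq, jumpSpace,
    Submodule.map_comap_eq, inf_eq_right.2 hle] at h1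
  rw [Module.finrank_fin_fun] at h2
  rw [jumpSpace, Matrix.rank, Matrix.rank]
  omega

end Border

/-- `j` is the least index with `v ∈ jumpSpace A j`. -/
def IsJump {m : ℕ} {F : Type*} [Field F] (A : Matrix (Fin m) (Fin m) F) (v : Fin m → F)
    (j : ℕ) : Prop :=
  v ∈ jumpSpace A j ∧ ∀ i < j, v ∉ jumpSpace A i

section Jump

variable {m : ℕ} {F : Type*} [Field F] {A : Matrix (Fin m) (Fin m) F} {v : Fin m → F}

theorem IsJump.mem_iff {j : ℕ} (h : IsJump A v j) (k : ℕ) : v ∈ jumpSpace A k ↔ j ≤ k :=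
  ⟨fun hk => not_lt.1 fun hlt => h.2 k hlt hk, fun hk => jumpSpace_mono A hk h.1⟩

theorem IsJump.unique {i j : ℕ} (hi : IsJump A v i) (hj : IsJump A v j) : i = j :=
  le_antisymm ((hi.mem_iff j).1 hj.1) ((hj.mem_iff i).1 hi.1)

theorem exists_isJump (hA : StrictUpper A) (v : Fin m → F) : ∃ j, IsJump A v j := by
  classical
  have h : ∃ j, v ∈ jumpSpace A j := ⟨m, mem_jumpSpace A v hA le_rfl⟩
  exact ⟨Nat.find h, Nat.find_spec h, fun i hi => Nat.find_min h hi⟩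

theorem IsJump.rank_border_pow {j : ℕ} (h : IsJump A v j) (k : ℕ) :
    (border A v ^ k).rank = (A ^ k).rank + if k ≤ j then 1 else 0 := by
  cases k with
  | zero => simp
  | succ k =>
    rw [_root_.rank_border_pow, h.mem_iff]
    split_ifs <;> omega

theorem IsJump.hasDualType_border_iff {j : ℕ} (h : IsJump A v j) (s : ℕ → ℕ) :
    HasDualType (border A v) s ↔
      0 < s j ∧ HasDualType A (Function.update s j (s j - 1)) := by
  have hr : ∀ k, (A ^ (k + 1)).rank ≤ (A ^ k).rank := fun k => by
    rw [pow_succ]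
    exact Matrix.rank_mul_le_left _ _
  simp only [HasDualType, h.rank_border_pow]
  constructor
  · intro H
    have hj := H j
    rw [if_pos le_rfl, if_neg (by omega)] at hj
    have := hr j
    refine ⟨by omega, fun k => ?_⟩
    rcases eq_or_ne k j with rfl | hk
    · rw [Function.update_self]
      omega
    · rw [Function.update_of_ne hk]
      have := H k
      split_ifs at this <;> omega
  · rintro ⟨hpos, H⟩ k
    have := H k
    rcases eq_or_ne k j with rfl | hk
    · rw [Function.update_self] at this
      rw [if_pos le_rfl, if_neg (by omega)]
      omega
    · rw [Function.update_of_ne hk] at this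
      split_ifs <;> omega

theorem StrictUpper.border (hA : StrictUpper A) (v : Fin m → F) :
    StrictUpper (border A v) := by
  intro i j
  refine Fin.lastCases (fun _ => by simp [_root_.border]) (fun i => ?_) i
  refine Fin.lastCases (fun h => ?_) (fun j h => ?_) j
  · simp at h
    omega
  · simpa [_root_.border] using hA i j (by simpa using h)

end Jump

section Count

variable {m : ℕ} {F : Type*} [Field F]

open Classical in
theorem indicator_hasDualType_border {A : Matrix (Fin m) (Fin m) F} (hA : StrictUpper A)
    (v : Fin m → F) {L : ℕ} {s : ℕ → ℕ} (hs : ∀ i, L ≤ i → s i = 0) :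
    (if HasDualType (border A v) s then 1 else 0 : ℤ) =
      ∑ j ∈ Finset.range L, if 0 < s j then
        (if HasDualType A (Function.update s j (s j - 1)) then
          (if IsJump A v j then 1 else 0) else 0) else 0 := by
  obtain ⟨j, hj⟩ := exists_isJump hA v
  rw [Finset.sum_eq_single j]
  · simp only [hj.hasDualType_border_iff, if_pos hj, ite_and]
  · intro i _ hij
    rw [if_neg fun h : IsJump A v i => hij (h.unique hj), ite_self, ite_self]
  · intro hjL
    rw [hs j (by simpa using hjL), if_neg (lt_irrefl 0)]

variable [Fintype F]

open Classical in
theorem sum_mem_submodule (W : Submodule F (Fin m → F)) :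
    (∑ v, if v ∈ W then 1 else 0 : ℤ) = (Fintype.card F : ℤ) ^ Module.finrank F W := by
  rw [Finset.sum_boole, ← Fintype.card_subtype]
  exact_mod_cast Module.card_eq_pow_finrank (K := F) (V := W)

open Classical in
theorem sum_isJump {A : Matrix (Fin m) (Fin m) F} {j : ℕ} {s : ℕ → ℕ} (hpos : 0 < s j)
    (hA : HasDualType A (Function.update s j (s j - 1))) :
    (∑ v, if IsJump A v j then 1 else 0 : ℤ) =
      (Fintype.card F : ℤ) ^ (m - (s j - 1)) -
        if j = 0 then 0 else (Fintype.card F : ℤ) ^ (m - s (j - 1)) := by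
  have hle : ∀ k, (A ^ k).rank ≤ m := fun k => by simpa using (A ^ k).rank_le_width
  have h1 : Module.finrank F (jumpSpace A j) = m - (s j - 1) := by
    have := finrank_jumpSpace A j
    have h := hA j
    rw [Function.update_self] at h
    have := hle j
    omega
  rw [← h1, ← sum_mem_submodule]
  cases j with
  | zero => simp [IsJump]
  | succ j =>
    have h2 : Module.finrank F (jumpSpace A j) = m - s j := by
      have := finrank_jumpSpace A j
      have h := hA j
      rw [Function.update_of_ne (by omega)] at h
      have := hle j
      omega
    rw [if_neg (by omega), Nat.add_sub_cancel, ← h2, ← sum_mem_submodule,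
      ← Finset.sum_sub_distrib]
    refine Finset.sum_congr rfl fun v _ => ?_
    have hmono : v ∈ jumpSpace A j → v ∈ jumpSpace A (j + 1) :=
      fun h => jumpSpace_mono A (Nat.le_succ j) h
    have hiff : IsJump A v (j + 1) ↔ v ∈ jumpSpace A (j + 1) ∧ v ∉ jumpSpace A j :=
      and_congr_right fun _ => ⟨fun h => h j (Nat.lt_succ_self j),
        fun h i hi hv => h (jumpSpace_mono A (Nat.lt_succ_iff.1 hi) hv)⟩
    rw [hiff]
    by_cases h3 : v ∈ jumpSpace A j
    · simp [h3, hmono h3]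
    · simp [h3]

/-- The number of strictly upper triangular matrices of dual Jordan type `s`. -/
noncomputable def dualTypeCount (m : ℕ) (s : ℕ → ℕ) (F : Type*) [Field F] [Fintype F] : ℕ :=
  Nat.card {A : {A : Matrix (Fin m) (Fin m) F // StrictUpper A} // HasDualType A.1 s}

open Classical in
theorem dualTypeCount_eq_sum (m : ℕ) (s : ℕ → ℕ) :
    (dualTypeCount m s F : ℤ) =
      ∑ A : {A : Matrix (Fin m) (Fin m) F // StrictUpper A},
        if HasDualType A.1 s then 1 else 0 := by
  rw [dualTypeCount, Nat.card_eq_fintype_card, Fintype.card_subtype, Finset.sum_boole]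

/-- A strictly upper triangular matrix is its leading block together with its last column. -/
def borderEquiv (m : ℕ) (F : Type*) [Field F] :
    {A : Matrix (Fin m) (Fin m) F // StrictUpper A} × (Fin m → F) ≃
      {B : Matrix (Fin (m + 1)) (Fin (m + 1)) F // StrictUpper B} where
  toFun p := ⟨border p.1.1 p.2, p.1.2.border p.2⟩
  invFun B := ⟨⟨B.1.submatrix Fin.castSucc Fin.castSucc,
    fun i j h => B.2 i.castSucc j.castSucc (by simpa using h)⟩,
    fun i => B.1 i.castSucc (Fin.last m)⟩
  left_inv p := by
    ext <;> simp [border]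
  right_inv B := by
    ext i j
    refine Fin.lastCases ?_ (fun i => ?_) i
    · simpa [border] using (B.2 (Fin.last m) j j.is_le).symm
    · refine Fin.lastCases ?_ (fun j => ?_) j <;> simp [border]

theorem dualTypeCount_succ {L : ℕ} {s : ℕ → ℕ} (hs : ∀ i, L ≤ i → s i = 0) :
    (dualTypeCount (m + 1) s F : ℤ) =
      ∑ j ∈ Finset.range L, if 0 < s j then
        (dualTypeCount m (Function.update s j (s j - 1)) F : ℤ) *
          ((Fintype.card F : ℤ) ^ (m - (s j - 1)) -
            if j = 0 then 0 else (Fintype.card F : ℤ) ^ (m - s (j - 1))) else 0 := by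
  classical
  rw [dualTypeCount_eq_sum, ← (borderEquiv m F).sum_comp, Fintype.sum_prod_type]
  have h : ∀ A : {A : Matrix (Fin m) (Fin m) F // StrictUpper A}, ∀ v : Fin m → F,
      (if HasDualType (borderEquiv m F (A, v)).1 s then 1 else 0 : ℤ) = _ :=
    fun A v => indicator_hasDualType_border A.2 v hs
  simp only [h]
  simp_rw [Finset.sum_comm (s := (Finset.univ : Finset (Fin m → F)))]
  rw [Finset.sum_comm]
  refine Finset.sum_congr rfl fun j _ => ?_
  by_cases hpos : 0 < s j
  · simp only [if_pos hpos]
    rw [dualTypeCount_eq_sum, Finset.sum_mul]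
    refine Finset.sum_congr rfl fun A _ => ?_
    by_cases hA : HasDualType A.1 (Function.update s j (s j - 1))
    · simpa only [if_pos hA, one_mul, ← Finset.sum_mul] using sum_isJump hpos hA
    · simp [hA]
  · simp [hpos]

theorem dualTypeCount_zero (s : ℕ → ℕ) [Decidable (s = 0)] :
    dualTypeCount 0 s F = if s = 0 then 1 else 0 := by
  have h : ∀ A : Matrix (Fin 0) (Fin 0) F, HasDualType A s ↔ s = 0 := fun A => by
    have hr : ∀ B : Matrix (Fin 0) (Fin 0) F, B.rank = 0 := fun B =>
      Nat.le_zero.1 (by simpa using B.rank_le_width)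
    simp [HasDualType, funext_iff, hr, eq_comm]
  have hU : ∀ A : Matrix (Fin 0) (Fin 0) F, StrictUpper A := fun A i => i.elim0
  split_ifs with hs
  · have : Unique {A : {A : Matrix (Fin 0) (Fin 0) F // StrictUpper A} // HasDualType A.1 s} :=
      { default := ⟨⟨0, hU 0⟩, (h 0).2 hs⟩
        uniq := fun A => Subsingleton.elim _ _ }
    exact Nat.card_unique
  · have : IsEmpty {A : {A : Matrix (Fin 0) (Fin 0) F // StrictUpper A} // HasDualType A.1 s} :=
      ⟨fun A => hs ((h _).1 A.2)⟩
    exact Nat.card_of_isEmpty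

end Count

section TypePoly

open Classical in
/-- The polynomial counting strictly upper triangular `m × m` matrices of dual Jordan type `s`,
for `s` supported below `L`. -/
noncomputable def typePoly (L : ℕ) : ℕ → (ℕ → ℕ) → ℤ[X]
  | 0, s => if s = 0 then 1 else 0
  | m + 1, s => ∑ j ∈ Finset.range L, if 0 < s j then
      typePoly L m (Function.update s j (s j - 1)) *
        (X ^ (m - (s j - 1)) - if j = 0 then 0 else X ^ (m - s (j - 1))) else 0

variable {L : ℕ}

theorem update_eq_zero_of_le {s : ℕ → ℕ} (hs : ∀ i, L ≤ i → s i = 0) (j : ℕ) :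
    ∀ i, L ≤ i → Function.update s j (s j - 1) i = 0 := by
  intro i hi
  rcases eq_or_ne i j with rfl | h
  · simp [hs i hi]
  · rw [Function.update_of_ne h, hs i hi]

theorem dualTypeCount_eq_eval {F : Type*} [Field F] [Fintype F] (m : ℕ) {s : ℕ → ℕ}
    (hs : ∀ i, L ≤ i → s i = 0) :
    (dualTypeCount m s F : ℤ) = (typePoly L m s).eval (Fintype.card F : ℤ) := by
  classical
  induction m generalizing s with
  | zero =>
    rw [dualTypeCount_zero, typePoly]
    split_ifs <;> simp
  | succ m ih =>
    rw [dualTypeCount_succ hs, typePoly, eval_finsetSum]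
    refine Finset.sum_congr rfl fun j _ => ?_
    rw [ih (update_eq_zero_of_le hs j)]
    split_ifs <;> simp

theorem typePoly_eq_zero (m : ℕ) {s : ℕ → ℕ} {i : ℕ} (hi : s i < s (i + 1)) :
    typePoly L m s = 0 := by
  induction m generalizing s with
  | zero =>
    rw [typePoly, if_neg]
    rintro rfl
    exact lt_irrefl _ hi
  | succ m ih =>
    rw [typePoly]
    refine Finset.sum_eq_zero fun j _ => ?_
    split_ifs with hpos h0
    · subst h0
      rw [ih, zero_mul]
      rw [Function.update_of_ne (show i + 1 ≠ 0 by omega)]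
      rcases eq_or_ne i 0 with rfl | h
      · rw [Function.update_self]
        omega
      · rwa [Function.update_of_ne h]
    · rcases eq_or_ne j (i + 1) with rfl | h
      · by_cases h' : s i = s (i + 1) - 1
        · rw [Nat.add_sub_cancel, h', sub_self, mul_zero]
        · rw [ih, zero_mul]
          rw [Function.update_self, Function.update_of_ne (by omega)]
          omega
      · rw [ih, zero_mul]
        rw [Function.update_of_ne (Ne.symm h)]
        rcases eq_or_ne i j with rfl | h'
        · rw [Function.update_self]
          omega
        · rwa [Function.update_of_ne h']
    · rfl

/-- The expected multiplicity of the root `0` of `typePoly L m s`. -/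
def typeOrder (L m : ℕ) (s : ℕ → ℕ) : ℤ :=
  (m.choose 2 : ℤ) - ((s 0).choose 2 : ℤ) - ∑ i ∈ Finset.range L, (s i : ℤ) * (s (i + 1) : ℤ)

theorem cast_update_pred {s : ℕ → ℕ} {j : ℕ} (hpos : 0 < s j) (i : ℕ) :
    (Function.update s j (s j - 1) i : ℤ) = s i - if i = j then 1 else 0 := by
  rcases eq_or_ne i j with rfl | h
  · rw [Function.update_self, if_pos rfl]
    omega
  · rw [Function.update_of_ne h, if_neg h, sub_zero]

theorem sum_update_pred {s : ℕ → ℕ} {j : ℕ} (hj : j < L) (hpos : 0 < s j) :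
    ∑ i ∈ Finset.range L, Function.update s j (s j - 1) i + 1 = ∑ i ∈ Finset.range L, s i := by
  zify
  simp only [cast_update_pred hpos, Finset.sum_sub_distrib]
  simp [hj]

theorem sum_mul_update_pred {s : ℕ → ℕ} {j : ℕ} (hj : j < L) (hpos : 0 < s j) :
    ∑ i ∈ Finset.range L, (Function.update s j (s j - 1) i : ℤ) *
        (Function.update s j (s j - 1) (i + 1) : ℤ) =
      ∑ i ∈ Finset.range L, (s i : ℤ) * (s (i + 1) : ℤ) - s (j + 1) -
        if j = 0 then 0 else (s (j - 1) : ℤ) := by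
  have h1 : ∑ i ∈ Finset.range L, (if i = j then (s (i + 1) : ℤ) else 0) = s (j + 1) := by
    rw [Finset.sum_ite_eq' (Finset.range L) j, if_pos (Finset.mem_range.2 hj)]
  have h2 : ∑ i ∈ Finset.range L, (if i + 1 = j then (s i : ℤ) else 0) =
      if j = 0 then 0 else (s (j - 1) : ℤ) := by
    cases j with
    | zero => simp
    | succ k =>
      simp only [Nat.add_right_cancel_iff]
      rw [Finset.sum_ite_eq' (Finset.range L) k, if_pos (Finset.mem_range.2 (by omega))]
      simp
  rw [← h1, ← h2, ← Finset.sum_sub_distrib, ← Finset.sum_sub_distrib]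
  refine Finset.sum_congr rfl fun i _ => ?_
  rw [cast_update_pred hpos, cast_update_pred hpos]
  split_ifs <;> first | omega | ring

theorem typeOrder_succ {m : ℕ} {s : ℕ → ℕ} {j : ℕ} (hj : j < L) (hpos : 0 < s j) :
    typeOrder L (m + 1) s + s (j + 1) =
      typeOrder L m (Function.update s j (s j - 1)) + m -
        if j = 0 then (s 0 : ℤ) - 1 else s (j - 1) := by
  have hm : ((m + 1).choose 2 : ℤ) = m + m.choose 2 := by
    rw [Nat.choose_succ_succ' m 1, Nat.choose_one_right, Nat.cast_add]
  rw [typeOrder, typeOrder, sum_mul_update_pred hj hpos, hm]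
  split_ifs with h
  · subst h
    obtain ⟨t, ht⟩ : ∃ t, s 0 = t + 1 := ⟨s 0 - 1, by omega⟩
    rw [Function.update_self, ht, Nat.add_sub_cancel, Nat.choose_succ_succ' t 1,
      Nat.choose_one_right]
    push_cast
    ring
  · rw [Function.update_of_ne (Ne.symm h)]
    ring

theorem exists_typePoly_eq (m : ℕ) {s : ℕ → ℕ} (hs : ∀ i, L ≤ i → s i = 0)
    (hanti : ∀ i, s (i + 1) ≤ s i) (hsum : ∑ i ∈ Finset.range L, s i = m) :
    ∃ (e : ℕ) (R : ℤ[X]), typePoly L m s = X ^ e * R ∧ R.eval 0 ≠ 0 ∧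
      (e : ℤ) = typeOrder L m s := by
  induction m generalizing s with
  | zero =>
    have h0 : s = 0 := by
      funext i
      by_cases hi : i < L
      · exact Finset.sum_eq_zero_iff.1 hsum i (Finset.mem_range.2 hi)
      · exact hs i (not_lt.1 hi)
    refine ⟨0, 1, ?_, ?_, ?_⟩
    · rw [typePoly, if_pos h0, pow_zero, one_mul]
    · simp
    · subst h0
      simp [typeOrder]
  | succ m ih =>
    have hlt : ∀ j, 0 < s j → j < L := fun j hpos => by
      by_contra h
      rw [hs j (not_lt.1 h)] at hpos
      exact lt_irrefl 0 hpos
    have hterm : ∀ j, 0 < s j → s (j + 1) < s j → ∃ (e : ℕ) (R : ℤ[X]),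
        typePoly L m (Function.update s j (s j - 1)) *
          (X ^ (m - (s j - 1)) - if j = 0 then 0 else X ^ (m - s (j - 1))) = X ^ e * R ∧
        R.eval 0 ≠ 0 ∧ (e : ℤ) = typeOrder L (m + 1) s + s (j + 1) := by
      intro j hpos hjs
      have hjL := hlt j hpos
      have hsum' : ∑ i ∈ Finset.range L, Function.update s j (s j - 1) i = m := by
        have := sum_update_pred hjL hpos
        omega
      have hle : ∀ i < L, Function.update s j (s j - 1) i ≤ m := fun i hi => by
        rw [← hsum']
        exact Finset.single_le_sum (f := Function.update s j (s j - 1))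
          (fun _ _ => Nat.zero_le _) (Finset.mem_range.2 hi)
      obtain ⟨e, R, hP, hR, he⟩ := ih (update_eq_zero_of_le hs j) (fun i => by
        have := hanti i
        simp only [Function.update_apply]
        split_ifs with h1 h2 h2
        · omega
        · subst h1
          omega
        · subst h2
          omega
        · exact this) hsum'
      have hord := typeOrder_succ (m := m) hjL hpos
      have hj' := hle j hjL
      rw [Function.update_self] at hj'
      rw [hP]
      cases j with
      | zero =>
        refine ⟨e + (m - (s 0 - 1)), R, ?_, hR, ?_⟩
        · rw [if_pos rfl]
          ring
        · rw [if_pos rfl] at hord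
          omega
      | succ k =>
        have hk := hle k (by omega)
        rw [Function.update_of_ne (by omega)] at hk
        have hks := hanti k
        refine ⟨e + (m - s k), R * (X ^ (s k - (s (k + 1) - 1)) - 1), ?_, ?_, ?_⟩
        · rw [if_neg (Nat.succ_ne_zero k), Nat.add_sub_cancel,
            show m - (s (k + 1) - 1) = (m - s k) + (s k - (s (k + 1) - 1)) by omega]
          ring
        · have : s k - (s (k + 1) - 1) ≠ 0 := by omega
          simpa [this] using hR
        · rw [if_neg (Nat.succ_ne_zero k), Nat.add_sub_cancel] at hord
          omega
    have hA : Antitone s := antitone_nat_of_succ_le hanti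
    obtain ⟨j₀, hj₀, hj₀'⟩ : ∃ j, 0 < s j ∧ s (j + 1) = 0 := by
      by_contra! h
      have : ∀ j, s j ≠ 0 := fun j => by
        induction j with
        | zero =>
          intro h0
          have : ∑ i ∈ Finset.range L, s i = 0 :=
            Finset.sum_eq_zero fun i _ => Nat.le_zero.1 (h0 ▸ hA (Nat.zero_le i))
          omega
        | succ j ihj => exact h j (Nat.pos_of_ne_zero ihj)
      exact this L (hs L le_rfl)
    obtain ⟨e, R, hP, hR, he⟩ := hterm j₀ hj₀ (by omega)
    rw [hj₀', Nat.cast_zero, add_zero] at he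
    have hdvd : X ^ (e + 1) ∣ ∑ j ∈ (Finset.range L).erase j₀, if 0 < s j then
        typePoly L m (Function.update s j (s j - 1)) *
          (X ^ (m - (s j - 1)) - if j = 0 then 0 else X ^ (m - s (j - 1))) else 0 := by
      refine Finset.dvd_sum fun j hj => ?_
      by_cases hpos : 0 < s j
      · rw [if_pos hpos]
        have hjj : j ≠ j₀ := Finset.ne_of_mem_erase hj
        have hnext : 0 < s (j + 1) := by
          rcases lt_or_gt_of_ne hjj with h | h
          · exact lt_of_lt_of_le hj₀ (hA h)
          · have := hA (Nat.succ_le_of_lt h)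
            rw [Nat.succ_eq_add_one] at this
            omega
        rcases lt_or_eq_of_le (hanti j) with h | h
        · obtain ⟨e', R', hP', -, he'⟩ := hterm j hpos h
          rw [hP']
          exact Dvd.dvd.mul_right (pow_dvd_pow _ (by omega)) _
        · rw [typePoly_eq_zero m (i := j), zero_mul]
          · exact dvd_zero _
          · rw [Function.update_self, Function.update_of_ne (by omega)]
            omega
      · rw [if_neg hpos]
        exact dvd_zero _
    obtain ⟨T, hT⟩ := hdvd
    refine ⟨e, R + X * T, ?_, by simpa using hR, he⟩
    rw [typePoly, ← Finset.add_sum_erase _ _ (Finset.mem_range.2 (hlt j₀ hj₀)), hT, if_pos hj₀, hP]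
    ring

end TypePoly

section Partition

variable {f : ℕ → ℕ} {n N : ℕ}

theorem sum_sub_eq_add_dualPart (f : ℕ → ℕ) (N k : ℕ) :
    ∑ i ∈ Finset.Icc 1 N, (f i - k) =
      ∑ i ∈ Finset.Icc 1 N, (f i - (k + 1)) + dualPart f N (k + 1) := by
  rw [dualPart, Finset.card_filter, ← Finset.sum_add_distrib]
  refine Finset.sum_congr rfl fun i _ => ?_
  split_ifs <;> omega

theorem sum_sub_eq_zero (hf : IsPartitionFun f n N) {k : ℕ} (hk : f 1 ≤ k) :
    ∑ i ∈ Finset.Icc 1 N, (f i - k) = 0 :=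
  Finset.sum_eq_zero fun i hi =>
    Nat.sub_eq_zero_of_le ((hf.1 1 i (Finset.mem_Icc.1 hi).1).trans hk)

theorem sum_dualPart (hf : IsPartitionFun f n N) :
    ∑ k ∈ Finset.range (f 1), dualPart f N (k + 1) = n := by
  have h : ∀ K, ∑ k ∈ Finset.range K, dualPart f N (k + 1) + ∑ i ∈ Finset.Icc 1 N, (f i - K) =
      n := fun K => by
    induction K with
    | zero => simpa using hf.2.2
    | succ K ih =>
      rw [sum_sub_eq_add_dualPart] at ih
      rw [Finset.sum_range_succ]
      omega
  simpa [sum_sub_eq_zero hf le_rfl] using h (f 1)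

theorem dualPart_succ_le (f : ℕ → ℕ) (N j : ℕ) : dualPart f N (j + 1) ≤ dualPart f N j :=
  Finset.card_le_card (Finset.monotone_filter_right _ fun _ _ h => (Nat.le_succ j).trans h)

theorem dualPart_eq_zero (hf : IsPartitionFun f n N) {j : ℕ} (hj : f 1 < j) :
    dualPart f N j = 0 := by
  refine Finset.card_eq_zero.2 (Finset.filter_eq_empty_iff.2 fun i hi h => ?_)
  have := hf.1 1 i (Finset.mem_Icc.1 hi).1
  omega

theorem dualPart_one (hf : IsPartitionFun f n N) : dualPart f N 1 = N := by
  rw [dualPart, Finset.filter_true_of_mem, Nat.card_Icc, Nat.add_sub_cancel]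
  intro i hi
  exact (hf.2.1 i (Finset.mem_Icc.1 hi).1).2 (Finset.mem_Icc.1 hi).2

theorem hasJordanType_iff_s7 (hf : IsPartitionFun f n N) {m : ℕ} {F : Type*} [Field F]
    {A : Matrix (Fin m) (Fin m) F} (hA : StrictUpper A) :
    HasJordanType A f N ↔ HasDualType A fun k => dualPart f N (k + 1) := by
  constructor
  · intro h k
    rw [h, h, sum_sub_eq_add_dualPart]
  · intro h
    have key : ∀ d k, max m (f 1) ≤ k + d →
        (A ^ k).rank = ∑ i ∈ Finset.Icc 1 N, (f i - k) := fun d => by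
      induction d with
      | zero =>
        intro k hk
        rw [add_zero] at hk
        rw [hA.pow_eq_zero ((le_max_left _ _).trans hk), Matrix.rank_zero,
          sum_sub_eq_zero hf ((le_max_right _ _).trans hk)]
      | succ d ih =>
        intro k hk
        rw [h k, ih (k + 1) (by omega), sum_sub_eq_add_dualPart f N k]
    exact fun k => key _ k (Nat.le_add_left _ _)

theorem jordanCount_eq_dualTypeCount (hf : IsPartitionFun f n N) (m : ℕ) (F : Type) [Field F]
    [Fintype F] :
    jordanCount m f N F = dualTypeCount m (fun k => dualPart f N (k + 1)) F := by
  refine Nat.card_congr ((Equiv.subtypeEquivRight fun A => ?_).trans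
    (Equiv.subtypeSubtypeEquivSubtypeInter StrictUpper
      fun A => HasDualType A fun k => dualPart f N (k + 1)).symm)
  exact and_congr_right fun hA => hasJordanType_iff_s7 hf hA

end Partition

theorem d_formula (n N : ℕ) (f : ℕ → ℕ) (hf : IsPartitionFun f n N)
    (P : Polynomial ℤ)
    (hP : ∀ (F : Type) [Field F] [Fintype F],
      (jordanCount n f N F : ℤ) = P.eval (Fintype.card F : ℤ)) :
    (P.rootMultiplicity 0 : ℤ) = (n.choose 2 : ℤ) - (N.choose 2 : ℤ) -
      ∑ i ∈ Finset.Icc 1 (f 1 - 1), (dualPart f N i : ℤ) * (dualPart f N (i + 1) : ℤ) := by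
  have hs : ∀ i, f 1 ≤ i → dualPart f N (i + 1) = 0 :=
    fun i hi => dualPart_eq_zero hf (Nat.lt_succ_of_le hi)
  have hPQ : P = typePoly (f 1) n fun k => dualPart f N (k + 1) := by
    refine eq_of_infinite_eval_eq _ _ ((Nat.infinite_setOfPred_prime.image
      (Nat.cast_injective (R := ℤ)).injOn).mono ?_)
    rintro _ ⟨p, hp, rfl⟩
    have : Fact p.Prime := ⟨hp⟩
    have h := hP (ZMod p)
    rw [jordanCount_eq_dualTypeCount hf, dualTypeCount_eq_eval (L := f 1) n hs, ZMod.card] at h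
    exact h.symm
  obtain ⟨e, R, hQ, hR, he⟩ := exists_typePoly_eq n hs
    (fun i => dualPart_succ_le f N (i + 1)) (sum_dualPart hf)
  have hR0 : R ≠ 0 := by
    rintro rfl
    simp at hR
  have hmult : P.rootMultiplicity 0 = e := by
    rw [hPQ, hQ, rootMultiplicity_mul (mul_ne_zero (pow_ne_zero _ X_ne_zero) hR0),
      rootMultiplicity_eq_zero hR, add_zero]
    simpa using rootMultiplicity_X_sub_C_pow (0 : ℤ) e
  rw [hmult, he, typeOrder, zero_add, dualPart_one hf]
  congr 1
  cases h1 : f 1 with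
  | zero => simp
  | succ L =>
    rw [Finset.sum_range_succ, hs (L + 1) h1.le, Nat.cast_zero, mul_zero, add_zero,
      Nat.add_sub_cancel, ← Finset.Ico_add_one_right_eq_Icc,
      Finset.sum_Ico_eq_sum_range, Nat.add_sub_cancel]
    simp only [add_comm 1]
end
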